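/- There exist a constant C and an injective encoding c : ℕ → List Bool whose image is prefix-free — for all m ≠ n, c(m) is not a prefix of c(n) — such that for every n ≥ 2 the codeword length satisfies length(c(n)) ≤ ⌊log₂ n⌋ + 2·⌊log₂(⌊log₂ n⌋ + 1)⌋ + C. (The recursive lg*-style self-delimiting code: the binary representation of n is prefixed by a self-delimiting encoding of its length, obtained by recursively concatenating the length, the length of the length, and so on.) -/

import Mathlib

/-- Comparison of two self-delimited strings: if the leading blocks have equal length, a prefix
relation between the concatenations splits blockwise. -/
theorem eq_and_prefix_of_append_prefix_append {α : Type*} {u v x y : List α}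
    (hlen : u.length = v.length) (h : u ++ x <+: v ++ y) : u = v ∧ x <+: y := by
  obtain ⟨t, ht⟩ := h
  rw [List.append_assoc] at ht
  obtain ⟨huv, hxy⟩ := List.append_inj ht hlen
  exact ⟨huv, t, hxy⟩

theorem eq_and_prefix_of_unary_prefix {a b : ℕ} {x y : List Bool}
    (h : List.replicate a true ++ false :: x <+: List.replicate b true ++ false :: y) :
    a = b ∧ x <+: y := by
  induction a generalizing b with
  | zero => cases b <;> simp_all [List.replicate_succ]
  | succ a ih =>
    cases b with
    | zero => simp [List.replicate_succ] at h
    | succ b =>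
      simp only [List.replicate_succ, List.cons_append, List.cons_prefix_cons, true_and] at h
      simpa using ih h

theorem nat_bits_injective : Function.Injective Nat.bits := by
  intro m n h
  have hd : Nat.digits 2 m = Nat.digits 2 n := by
    rw [Nat.digits_two_eq_bits, Nat.digits_two_eq_bits, h]
  exact Nat.digits_inj_iff.1 hd

theorem nat_size_eq_log_two_add_one {n : ℕ} (hn : n ≠ 0) : n.size = Nat.log 2 n + 1 := by
  have h := congrArg List.length (Nat.digits_two_eq_bits n)
  rw [List.length_map, Nat.size_eq_bits_len, Nat.length_digits 2 n one_lt_two hn] at h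
  exact h.symm

/-- The self-delimiting code obtained by prefixing the binary digits of `n` with the binary digits
of their number, preceded in turn by the number of those in unary. -/
def logStarCode (n : ℕ) : List Bool :=
  List.replicate n.size.size true ++ false :: (n.size.bits ++ n.bits)

theorem eq_of_logStarCode_prefix {m n : ℕ} (h : logStarCode m <+: logStarCode n) : m = n := by
  obtain ⟨hss, h⟩ := eq_and_prefix_of_unary_prefix h
  obtain ⟨hs, h⟩ := eq_and_prefix_of_append_prefix_append
    (by rw [Nat.size_eq_bits_len, Nat.size_eq_bits_len, hss]) h
  apply nat_bits_injective
  apply h.eq_of_length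
  rw [Nat.size_eq_bits_len, Nat.size_eq_bits_len]
  exact nat_bits_injective hs

theorem length_logStarCode {n : ℕ} (hn : n ≠ 0) :
    (logStarCode n).length = Nat.log 2 n + 2 * Nat.log 2 (Nat.log 2 n + 1) + 4 := by
  have hs := nat_size_eq_log_two_add_one hn
  have hss := nat_size_eq_log_two_add_one (Nat.succ_ne_zero (Nat.log 2 n))
  simp only [logStarCode, List.length_append, List.length_replicate, List.length_cons,
    Nat.size_eq_bits_len, hs, hss, Nat.succ_eq_add_one]
  ring

theorem exists_log_star_prefix_free_code :
    ∃ (C : ℕ) (c : ℕ → List Bool),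
      Function.Injective c ∧
      (∀ m n : ℕ, m ≠ n → ¬ (c m <+: c n)) ∧
      (∀ n : ℕ, 2 ≤ n →
        (c n).length ≤ Nat.log 2 n + 2 * Nat.log 2 (Nat.log 2 n + 1) + C) :=
  ⟨4, logStarCode, fun _ _ h => eq_of_logStarCode_prefix (h ▸ List.prefix_refl _),
    fun _ _ hmn h => hmn (eq_of_logStarCode_prefix h),
    fun _ hn => (length_logStarCode (by lia)).le⟩
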